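/- arXiv:2509.25150 — 2 statements merged into one kernel-verified Lean document; each statement's English description precedes it below -/
import Mathlib

section
/- Every marriage instance with arbitrary nonnegative agent weights and preference lists that may contain ties admits a popular winning set of cardinality 3: there exist matchings M₁, M₂, M₃ such that for every matching M', φ({M₁, M₂, M₃}, M') ≥ φ(M', {M₁, M₂, M₃}). -/
open scoped Classical

/-- `M` is a matching in the marriage instance with adjacency `E`:
every man occurs in at most one pair and every woman occurs in at most one pair. -/
def MG.IsMatching {α β : Type*} (E M : Finset (α × β)) : Prop :=
  M ⊆ E ∧ (∀ p ∈ M, ∀ q ∈ M, p.1 = q.1 → p = q) ∧ (∀ p ∈ M, ∀ q ∈ M, p.2 = q.2 → p = q)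

/-- Man `i` strictly prefers matching `M` over matching `M'`. -/
def MG.PrefersA {α β : Type*} (rA : α → β → ℕ) (M M' : Finset (α × β)) (i : α) : Prop :=
  ∃ p ∈ M, p.1 = i ∧ ∀ q ∈ M', q.1 = i → rA i p.2 < rA i q.2

/-- Woman `j` strictly prefers matching `M` over matching `M'`. -/
def MG.PrefersB {α β : Type*} (rB : β → α → ℕ) (M M' : Finset (α × β)) (j : β) : Prop :=
  ∃ p ∈ M, p.2 = j ∧ ∀ q ∈ M', q.2 = j → rB j p.1 < rB j q.1

/-- `φ(M, M')`: total weight of agents (men and women) strictly preferring `M` over `M'`. -/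
noncomputable def MG.phi {α β : Type*} [Fintype α] [Fintype β]
    (wA : α → ℝ) (wB : β → ℝ) (rA : α → β → ℕ) (rB : β → α → ℕ)
    (M M' : Finset (α × β)) : ℝ :=
  (∑ i, if MG.PrefersA rA M M' i then wA i else 0) +
    (∑ j, if MG.PrefersB rB M M' j then wB j else 0)

/-- `φ(𝓜, M')`: total weight of agents strictly preferring some matching of `𝓜` over `M'`. -/
noncomputable def MG.phiSet {α β : Type*} [Fintype α] [Fintype β]
    (wA : α → ℝ) (wB : β → ℝ) (rA : α → β → ℕ) (rB : β → α → ℕ)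
    (𝓜 : Set (Finset (α × β))) (M' : Finset (α × β)) : ℝ :=
  (∑ i, if ∃ M ∈ 𝓜, MG.PrefersA rA M M' i then wA i else 0) +
    (∑ j, if ∃ M ∈ 𝓜, MG.PrefersB rB M M' j then wB j else 0)

/-- `φ(M', 𝓜)`: total weight of agents strictly preferring `M'` over every matching of `𝓜`. -/
noncomputable def MG.phiSet' {α β : Type*} [Fintype α] [Fintype β]
    (wA : α → ℝ) (wB : β → ℝ) (rA : α → β → ℕ) (rB : β → α → ℕ)
    (M' : Finset (α × β)) (𝓜 : Set (Finset (α × β))) : ℝ :=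
  (∑ i, if ∀ M ∈ 𝓜, MG.PrefersA rA M' M i then wA i else 0) +
    (∑ j, if ∀ M ∈ 𝓜, MG.PrefersB rB M' M j then wB j else 0)
namespace MG

/-! ### Decomposition of bipartite multigraphs of bounded degree into matchings -/

section Decomposition

variable {n : Type*} [Fintype n]

/-- A nonnegative integer matrix with constant positive row and column sums has a permutation
in its support. -/
lemma exists_perm_of_regular {d : ℕ} (hd : 0 < d) (N : n → n → ℕ)
    (hr : ∀ i, ∑ j, N i j = d) (hc : ∀ j, ∑ i, N i j = d) :
    ∃ σ : Equiv.Perm n, ∀ i, N i (σ i) ≠ 0 := by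
  have hall : ∀ s : Finset n,
      s.card ≤ (s.biUnion fun i => Finset.univ.filter fun j => N i j ≠ 0).card := by
    intro s
    set t := s.biUnion fun i => Finset.univ.filter fun j => N i j ≠ 0 with ht
    have h1 : ∑ i ∈ s, ∑ j, N i j = ∑ i ∈ s, ∑ j ∈ t, N i j := by
      refine Finset.sum_congr rfl fun i hi => ?_
      refine (Finset.sum_subset (Finset.subset_univ t) fun j _ hj => ?_).symm
      by_contra h
      exact hj (Finset.mem_biUnion.2 ⟨i, hi, by simpa using h⟩)
    have h2 : ∑ j ∈ t, ∑ i ∈ s, N i j ≤ ∑ j ∈ t, ∑ i, N i j :=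
      Finset.sum_le_sum fun j _ => Finset.sum_le_sum_of_subset (Finset.subset_univ s)
    rw [Finset.sum_comm] at h2
    simp only [hr, hc, Finset.sum_const, smul_eq_mul] at h1 h2
    exact Nat.le_of_mul_le_mul_right (h1.trans_le h2) hd
  obtain ⟨f, hf, hN⟩ := (Finset.all_card_le_biUnion_card_iff_exists_injective _).1 hall
  refine ⟨Equiv.ofBijective f (Finite.injective_iff_bijective.1 hf), fun i => ?_⟩
  simpa using hN i

/-- The support of a nonnegative integer matrix with all row and column sums equal to `d` is
covered by `d` permutations contained in it. -/
lemma exists_perms_of_regular (d : ℕ) (N : n → n → ℕ)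
    (hr : ∀ i, ∑ j, N i j = d) (hc : ∀ j, ∑ i, N i j = d) :
    ∃ σ : Fin d → Equiv.Perm n, ∀ i j, N i j ≠ 0 ↔ ∃ k, σ k i = j := by
  induction d generalizing N with
  | zero =>
    refine ⟨Fin.elim0, fun i j => ?_⟩
    have := Finset.sum_eq_zero_iff.1 (hr i) j (Finset.mem_univ j)
    simp [this]
  | succ d ih =>
    obtain ⟨τ, hτ⟩ := exists_perm_of_regular d.succ_pos N hr hc
    have hsplit : ∀ i j, N i j = (N i j - if τ i = j then 1 else 0) + if τ i = j then 1 else 0 := by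
      intro i j
      have := hτ i
      split_ifs with h
      · subst h; omega
      · simp
    obtain ⟨σ, hσ⟩ := ih (fun i j => N i j - if τ i = j then 1 else 0)
      (fun i => by
        have := hr i
        rw [Finset.sum_congr rfl fun j _ => hsplit i j, Finset.sum_add_distrib] at this
        simpa using this)
      (fun j => by
        have := hc j
        rw [Finset.sum_congr rfl fun i _ => hsplit i j, Finset.sum_add_distrib] at this
        have h1 : ∑ i, (if τ i = j then 1 else 0) = 1 := by
          simp [← Equiv.eq_symm_apply]
        omega)
    refine ⟨Fin.cons τ σ, fun i j => ?_⟩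
    rw [Fin.exists_fin_succ]
    simp only [Fin.cons_zero, Fin.cons_succ, ← hσ]
    by_cases h : τ i = j
    · subst h; simpa using hτ i
    · simp [h]

end Decomposition

variable {α β : Type*}

/-- A bipartite multigraph of maximum degree at most `d` is the union of `d` matchings. -/
lemma exists_matchings_of_degree_le [Fintype α] [Fintype β] (E : Finset (α × β)) (d : ℕ)
    (N : α → β → ℕ) (hE : ∀ a b, N a b ≠ 0 → (a, b) ∈ E)
    (hr : ∀ a, ∑ b, N a b ≤ d) (hc : ∀ b, ∑ a, N a b ≤ d) :
    ∃ M : Fin d → Finset (α × β), (∀ k, IsMatching E (M k)) ∧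
      ∀ a b, N a b ≠ 0 → ∃ k, (a, b) ∈ M k := by
  let e : α ⊕ β ≃ β ⊕ α := Equiv.sumComm α β
  let P : α ⊕ β → β ⊕ α → ℕ
    | .inl a, .inl b => N a b
    | .inl a, .inr a' => if a = a' then d - ∑ b, N a b else 0
    | .inr b, .inl b' => if b = b' then d - ∑ a, N a b else 0
    | .inr b, .inr a => N a b
  obtain ⟨σ, hσ⟩ := exists_perms_of_regular d (fun i j => P i (e j))
    (by
      intro i
      rw [Equiv.sum_comp e (P i), Fintype.sum_sum_type]
      rcases i with a | b
      · simpa [P] using Nat.add_sub_cancel' (hr a)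
      · simpa [P] using Nat.sub_add_cancel (hc b))
    (by
      intro j
      rw [Fintype.sum_sum_type]
      rcases j with a | b
      · simpa [P, e] using Nat.sub_add_cancel (hr a)
      · simpa [P, e] using Nat.add_sub_cancel' (hc b))
  refine ⟨fun k => Finset.univ.filter fun p => σ k (.inl p.1) = .inr p.2,
    fun k => ⟨?_, ?_, ?_⟩, fun a b h => ?_⟩
  · rintro ⟨a, b⟩ h
    exact hE a b ((hσ (.inl a) (.inr b)).2 ⟨k, by simpa using h⟩)
  · rintro ⟨a, b⟩ h ⟨a', b'⟩ h' (rfl : a = a')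
    simp only [Finset.mem_filter, Finset.mem_univ, true_and] at h h'
    simpa using h.symm.trans h'
  · rintro ⟨a, b⟩ h ⟨a', b'⟩ h' (rfl : b = b')
    simp only [Finset.mem_filter, Finset.mem_univ, true_and] at h h'
    simpa using (σ k).injective (h.trans h'.symm)
  · obtain ⟨k, hk⟩ := (hσ (.inl a) (.inr b)).1 h
    exact ⟨k, by simpa using hk⟩

lemma sum_ite_eq_some_le_one [Fintype β] (o : Option β) :
    ∑ b, (if o = some b then 1 else 0) ≤ 1 := by
  cases o <;> simp

/-! ### One-sided assignments with capacity two -/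

/-- If at every threshold `L` has at least as many elements of weight above the threshold as `G`,
then `L` weighs at least as much as `G`. -/
lemma sum_le_sum_of_card_threshold_le (w : α → ℝ) (hw : ∀ a, 0 ≤ w a) (G L : Finset α)
    (h : ∀ t, (G.filter fun a => t ≤ w a).card ≤ (L.filter fun a => t ≤ w a).card) :
    ∑ a ∈ G, w a ≤ ∑ a ∈ L, w a := by
  have hall : ∀ s : Finset G,
      s.card ≤ (s.biUnion fun x => L.filter fun a => w x ≤ w a).card := by
    intro s
    rcases s.eq_empty_or_nonempty with rfl | hs
    · simp
    obtain ⟨x, hx, hmin⟩ := s.exists_min_image (fun x => w x) hs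
    calc s.card = (s.map (Function.Embedding.subtype _)).card := (Finset.card_map _).symm
      _ ≤ (G.filter fun a => w x ≤ w a).card := by
        refine Finset.card_le_card fun a ha => ?_
        obtain ⟨y, hy, rfl⟩ := Finset.mem_map.1 ha
        exact Finset.mem_filter.2 ⟨y.2, hmin y hy⟩
      _ ≤ (L.filter fun a => w x ≤ w a).card := h _
      _ ≤ _ := Finset.card_le_card (Finset.subset_biUnion_of_mem
        (fun x : G => L.filter fun a => w x ≤ w a) hx)
  obtain ⟨φ, hφ, hL⟩ := (Finset.all_card_le_biUnion_card_iff_exists_injective _).1 hall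
  simp only [Finset.mem_filter] at hL
  calc ∑ a ∈ G, w a = ∑ x : G, w x := (Finset.sum_coe_sort G w).symm
    _ ≤ ∑ x : G, w (φ x) := Finset.sum_le_sum fun x _ => (hL x).2
    _ = ∑ a ∈ Finset.univ.image φ, w a := (Finset.sum_image hφ.injOn).symm
    _ ≤ ∑ a ∈ L, w a := Finset.sum_le_sum_of_subset_of_nonneg
        (by intro a ha; obtain ⟨x, -, rfl⟩ := Finset.mem_image.1 ha; exact (hL x).1)
        fun a _ _ => hw a

/-- Among finitely many value vectors there is one in which nobody can be improved without
harming somebody of at least the same weight. -/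
lemma exists_priority_optimal [Fintype α] {ι : Type*} (w : α → ℝ) (s : Finset ι) (hs : s.Nonempty)
    (v : ι → α → ℕ) :
    ∃ f ∈ s, ∀ g ∈ s, ∀ a, (∀ y, w a ≤ w y → v f y ≤ v g y) → v g a ≤ v f a := by
  let V : α → ℕ := fun y => ∑ f ∈ s, v f y
  let C : ℕ := 1 + ∑ y, V y
  let m : α → ℕ := fun a => (Finset.univ.filter fun x => w x < w a).card
  have hm : ∀ x a, w x < w a → m x < m a := by
    intro x a h
    refine Finset.card_lt_card (Finset.ssubset_iff_of_subset ?_ |>.2 ⟨x, by simpa using h, by simp⟩)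
    intro y hy
    simp only [Finset.mem_filter, Finset.mem_univ, true_and] at hy ⊢
    exact hy.trans h
  obtain ⟨f, hf, hmax⟩ := s.exists_max_image (fun f => ∑ y, C ^ m y * v f y) hs
  refine ⟨f, hf, fun g hg a hle => ?_⟩
  by_contra! hlt
  have hC : 0 < C := by simp [C]
  have key : ∀ y, C * (C ^ m y * v f y) + (if y = a then C ^ (m a + 1) else 0) ≤
      C * (C ^ m y * v g y) + C ^ m a * V y := by
    intro y
    by_cases hya : y = a
    · subst hya
      simp only [if_true]
      calc C * (C ^ m y * v f y) + C ^ (m y + 1) = C * (C ^ m y * (v f y + 1)) := by ring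
        _ ≤ C * (C ^ m y * v g y) := by gcongr; exact hlt
        _ ≤ _ := Nat.le_add_right _ _
    · simp only [hya, if_false, add_zero]
      by_cases hwy : w a ≤ w y
      · calc C * (C ^ m y * v f y) ≤ C * (C ^ m y * v g y) := by gcongr; exact hle y hwy
          _ ≤ _ := Nat.le_add_right _ _
      · calc C * (C ^ m y * v f y) = C ^ (m y + 1) * v f y := by ring
          _ ≤ C ^ m a * V y := by
            gcongr
            · exact hm y a (not_le.1 hwy)
            · exact Finset.single_le_sum (f := fun f => v f y) (fun _ _ => Nat.zero_le _) hf
          _ ≤ _ := Nat.le_add_left _ _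
  have hsum := Finset.sum_le_sum fun y (_ : y ∈ Finset.univ) => key y
  simp only [Finset.sum_add_distrib, ← Finset.mul_sum, Finset.sum_ite_eq', Finset.mem_univ,
    if_true] at hsum
  have h1 : C * ∑ y, C ^ m y * v g y ≤ C * ∑ y, C ^ m y * v f y :=
    Nat.mul_le_mul_left _ (hmax g hg)
  have h2 : C ^ m a * ∑ y, V y < C ^ (m a + 1) := by
    rw [pow_succ]
    exact Nat.mul_lt_mul_of_pos_left (by simp [C]) (pow_pos hC _)
  omega

/-- Number of agents assigned to `b`. -/
noncomputable def load [Fintype α] (f : α → Option β) (b : β) : ℕ :=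
  (Finset.univ.filter fun a => f a = some b).card

lemma load_update [Fintype α] (g : α → Option β) (x : α) (o : Option β) (c : β) :
    load (Function.update g x o) c + (if g x = some c then 1 else 0) =
      load g c + (if o = some c then 1 else 0) := by
  have h : ∀ f : α → Option β, load f c =
      (if f x = some c then 1 else 0) + ∑ a ∈ Finset.univ.erase x, if f a = some c then 1 else 0 := by
    intro f
    rw [load, Finset.card_filter, Finset.add_sum_erase _ (fun a => if f a = some c then 1 else 0)
      (Finset.mem_univ x)]
  have h2 : ∑ a ∈ Finset.univ.erase x, (if Function.update g x o a = some c then 1 else 0) =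
      ∑ a ∈ Finset.univ.erase x, if g a = some c then 1 else 0 :=
    Finset.sum_congr rfl fun a ha => by rw [Function.update_of_ne (Finset.ne_of_mem_erase ha)]
  rw [h, h g, h2, Function.update_self]
  omega

/-- `Chain v f m a g b`: starting from the assignment `f`, agent `a` moves to its partner in `m`,
then repeatedly an agent assigned to the last reached `b`, indifferent between `f` and `m`, moves to
its partner in `m`. The resulting assignment is `g`, and the last reached partner is `b`. -/
inductive Chain (v : α → Option β → ℕ) (f m : α → Option β) (a : α) :
    (α → Option β) → β → Prop
  | base {b : β} : m a = some b → Chain v f m a (Function.update f a (some b)) b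
  | step {g : α → Option β} {b c : β} {x : α} : Chain v f m a g b → g x = some b →
      f x = some b → m x = some c → v x (m x) = v x (f x) →
      Chain v f m a (Function.update g x (some c)) c

section Chain

variable {v : α → Option β → ℕ} {f m g : α → Option β} {a : α} {b : β}

lemma Chain.load_le [Fintype α] (h : Chain v f m a g b) (c : β) :
    load g c ≤ load f c + if b = c then 1 else 0 := by
  induction h with
  | @base b _ =>
    have := load_update f a (some b) c
    simp only [Option.some.injEq] at this
    omega
  | @step g b d x _ hgx _ _ _ ih =>
    have := load_update g x (some d) c
    simp only [hgx, Option.some.injEq] at this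
    omega

lemma Chain.mem (h : Chain v f m a g b) {E : α → β → Prop} (hf : ∀ a b, f a = some b → E a b)
    (hm : ∀ a b, m a = some b → E a b) (x : α) (c : β) (hg : g x = some c) : E x c := by
  induction h with
  | @base b hb =>
    by_cases hx : x = a
    · subst hx; rw [Function.update_self] at hg; exact hm _ _ (hb.trans hg)
    · rw [Function.update_of_ne hx] at hg; exact hf _ _ hg
  | @step g b d y _ _ _ hd _ ih =>
    by_cases hx : x = y
    · subst hx; rw [Function.update_self] at hg; exact hm _ _ (hd.trans hg)
    · rw [Function.update_of_ne hx] at hg; exact ih hg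

lemma Chain.value_eq (h : Chain v f m a g b) (ha : v a (f a) < v a (m a)) :
    v a (g a) = v a (m a) ∧ ∀ x, x ≠ a → v x (g x) = v x (f x) := by
  induction h with
  | @base b hb =>
    refine ⟨by rw [Function.update_self, hb], fun x hx => by rw [Function.update_of_ne hx]⟩
  | @step g b d y _ _ _ hd hv ih =>
    have hya : a ≠ y := by rintro rfl; omega
    refine ⟨by rw [Function.update_of_ne hya]; exact ih.1, fun x hx => ?_⟩
    by_cases hxy : x = y
    · subst hxy; rw [Function.update_self, ← hd, hv]
    · rw [Function.update_of_ne hxy]; exact ih.2 x hx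

/-- Every agent displaced along a chain was a current member of an earlier chain. -/
lemma Chain.moved (h : Chain v f m a g b) (x : α) (hx : g x ≠ f x) :
    x = a ∨ ∃ g' b', Chain v f m a g' b' ∧ g' x = some b' ∧ f x = some b' := by
  induction h with
  | @base b hb =>
    by_cases hxa : x = a
    · exact Or.inl hxa
    · rw [Function.update_of_ne hxa] at hx; exact absurd rfl hx
  | @step g b d y hc hg hf _ _ ih =>
    by_cases hxy : x = y
    · subst hxy; exact Or.inr ⟨g, b, hc, hg, hf⟩
    · rw [Function.update_of_ne hxy] at hx; exact ih hx

end Chain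

/-- There is an assignment using every `b` at most twice such that no matching beats it in a
weighted vote of the agents on the left. -/
lemma exists_popular_assignment [Fintype α] [Fintype β] (E : α → β → Prop)
    (w : α → ℝ) (hw : ∀ a, 0 ≤ w a) (v : α → Option β → ℕ) (hv : ∀ a b, v a none < v a (some b)) :
    ∃ f : α → Option β, (∀ a b, f a = some b → E a b) ∧ (∀ b, load f b ≤ 2) ∧
      ∀ m : α → Option β, (∀ a b, m a = some b → E a b) →
        (∀ a a' b, m a = some b → m a' = some b → a = a') →
        ∑ a with v a (f a) < v a (m a), w a ≤ ∑ a with v a (m a) < v a (f a), w a := by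
  let s : Finset (α → Option β) := Finset.univ.filter fun f =>
    (∀ a b, f a = some b → E a b) ∧ ∀ b, load f b ≤ 2
  have hs : s.Nonempty := ⟨fun _ => none, Finset.mem_filter.2 ⟨Finset.mem_univ _, by simp [load]⟩⟩
  obtain ⟨f, hf, hopt⟩ := exists_priority_optimal w s hs fun f a => v a (f a)
  simp only [s, Finset.mem_filter, Finset.mem_univ, true_and] at hf hopt
  refine ⟨f, hf.1, hf.2, fun m hmE hminj => ?_⟩
  have hfull : ∀ a g b, v a (f a) < v a (m a) → Chain v f m a g b → 2 < load g b := by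
    intro a g b ha hc
    by_contra! hle
    have hval := hc.value_eq ha
    have h1 := hopt g ⟨hc.mem hf.1 hmE, fun c => ?_⟩ a fun y _ => ?_
    · omega
    · by_cases hbc : b = c
      · subst hbc; exact hle
      · have := hc.load_le c
        have := hf.2 c
        simp only [hbc, if_false] at *
        omega
    · by_cases hy : y = a
      · subst hy; omega
      · exact (hval.2 y hy).ge
  have hprio : ∀ a g b x, v a (f a) < v a (m a) → Chain v f m a g b → g x = some b →
      w a ≤ w x := by
    intro a g b x ha hc hx
    by_contra! hlt
    have hval := hc.value_eq ha
    have hax : a ≠ x := by rintro rfl; exact lt_irrefl _ hlt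
    have h1 := hopt (Function.update g x none) ⟨fun y c hy => ?_, fun c => ?_⟩ a fun y hwy => ?_
    · rw [Function.update_of_ne hax] at h1; omega
    · by_cases hyx : y = x
      · subst hyx; simp at hy
      · rw [Function.update_of_ne hyx] at hy; exact hc.mem hf.1 hmE y c hy
    · have h2 := load_update g x none c
      have := hc.load_le c
      have := hf.2 c
      simp only [hx, Option.some.injEq, reduceCtorEq, if_false] at h2
      omega
    · have hyx : y ≠ x := by rintro rfl; exact absurd hwy (not_le.2 hlt)
      rw [Function.update_of_ne hyx]
      by_cases hy : y = a
      · subst hy; omega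
      · exact (hval.2 y hy).ge
  have hreach : ∀ a g b x, v a (f a) < v a (m a) → Chain v f m a g b → f x = some b →
      w a ≤ w x ∧ (v x (m x) = v x (f x) → ∃ g' c, m x = some c ∧ Chain v f m a g' c) := by
    intro a g b x ha hc hx
    have hnext : ∀ g b, Chain v f m a g b → g x = some b → f x = some b →
        w a ≤ w x ∧ (v x (m x) = v x (f x) → ∃ g' c, m x = some c ∧ Chain v f m a g' c) := by
      intro g b hc hgx hfx
      refine ⟨hprio a g b x ha hc hgx, fun heq => ?_⟩
      cases hmx : m x with
      | none =>
        have := hv x b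
        rw [hmx, hfx] at heq
        omega
      | some c => exact ⟨_, c, rfl, hc.step hgx hfx hmx heq⟩
    by_cases hgf : g x = f x
    · exact hnext g b hc (hgf.trans hx) hx
    · rcases hc.moved x hgf with rfl | ⟨g', b', hc', hg', hf'⟩
      · exact ⟨le_rfl, fun heq => by omega⟩
      · exact hnext g' b' hc' hg' hf'
  refine sum_le_sum_of_card_threshold_le w hw _ _ fun t => ?_
  let R : Finset β := Finset.univ.filter fun b =>
    ∃ a g, v a (f a) < v a (m a) ∧ t ≤ w a ∧ Chain v f m a g b
  let O : Finset α := Finset.univ.filter fun x => ∃ b ∈ R, f x = some b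
  let G : Finset α := (Finset.univ.filter fun a => v a (f a) < v a (m a)).filter fun a => t ≤ w a
  let L : Finset α := (Finset.univ.filter fun a => v a (m a) < v a (f a)).filter fun a => t ≤ w a
  let T : Finset α := O.filter fun x => v x (m x) = v x (f x)
  change G.card ≤ L.card
  have hO : 2 * R.card ≤ O.card := by
    have hOR : O = R.biUnion fun b => Finset.univ.filter fun x => f x = some b := by
      ext x; simp [O]
    rw [hOR, Finset.card_biUnion]
    · rw [mul_comm, ← smul_eq_mul, ← Finset.sum_const]
      refine Finset.sum_le_sum fun b hb => ?_
      obtain ⟨a, g, ha, -, hc⟩ := (Finset.mem_filter.1 hb).2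
      have h1 := hfull a g b ha hc
      have h2 := hc.load_le b
      simp only [if_true] at h2
      change 2 ≤ load f b
      omega
    · intro b _ c _ hbc
      refine Finset.disjoint_left.2 fun x hx hx' => hbc ?_
      simp only [Finset.mem_filter, Finset.mem_univ, true_and] at hx hx'
      simpa using hx.symm.trans hx'
  have hGT : (G ∪ T).card ≤ R.card := by
    have hex : ∀ x ∈ G ∪ T, ∃ b, b ∈ R ∧ m x = some b := by
      intro x hx
      rcases Finset.mem_union.1 hx with hx | hx
      · simp only [G, Finset.mem_filter, Finset.mem_univ, true_and] at hx
        cases hmx : m x with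
        | none =>
          have h1 := hx.1
          rw [hmx] at h1
          cases hfx : f x with
          | none => rw [hfx] at h1; omega
          | some b => have := hv x b; rw [hfx] at h1; omega
        | some b =>
          exact ⟨b, Finset.mem_filter.2 ⟨Finset.mem_univ _, x, _, hx.1, hx.2, .base hmx⟩, rfl⟩
      · simp only [T, O, Finset.mem_filter, Finset.mem_univ, true_and] at hx
        obtain ⟨⟨b, hb, hfx⟩, heq⟩ := hx
        obtain ⟨a, g, ha, hta, hc⟩ := (Finset.mem_filter.1 hb).2
        obtain ⟨g', c, hmx, hc'⟩ := (hreach a g b x ha hc hfx).2 heq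
        exact ⟨c, Finset.mem_filter.2 ⟨Finset.mem_univ _, a, g', ha, hta, hc'⟩, hmx⟩
    choose p hpR hp using hex
    refine Finset.card_le_card_of_injective (f := fun x : ↥(G ∪ T) => ⟨p x x.2, hpR x x.2⟩) ?_
    rintro ⟨x, hx⟩ ⟨y, hy⟩ hxy
    have hxy : p x hx = p y hy := congrArg Subtype.val hxy
    exact Subtype.ext (hminj x y _ (hp x hx) (hxy ▸ hp y hy))
  have hdisj : (G ∪ T).card = G.card + T.card := by
    refine Finset.card_union_of_disjoint (Finset.disjoint_left.2 fun x hx hx' => ?_)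
    simp only [G, T, Finset.mem_filter, Finset.mem_univ, true_and] at hx hx'
    omega
  have hcover : O ⊆ (G ∪ L) ∪ T := by
    intro x hx
    obtain ⟨b, hb, hfx⟩ := (Finset.mem_filter.1 hx).2
    obtain ⟨a, g, ha, hta, hc⟩ := (Finset.mem_filter.1 hb).2
    have htx := hta.trans (hreach a g b x ha hc hfx).1
    simp only [G, L, T, Finset.mem_union, Finset.mem_filter, Finset.mem_univ, true_and, htx, hx,
      and_true]
    omega
  have h1 := Finset.card_le_card hcover
  have h2 := Finset.card_union_le (G ∪ L) T
  have h3 := Finset.card_union_le G L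
  omega

/-- Version of `exists_popular_assignment` for rank functions and matchings given as relations. -/
lemma exists_popular_assignment_rank [Fintype α] [Fintype β] (E : α → β → Prop)
    (w : α → ℝ) (hw : ∀ a, 0 ≤ w a) (r : α → β → ℕ) :
    ∃ f : α → Option β, (∀ a b, f a = some b → E a b) ∧ (∀ b, load f b ≤ 2) ∧
      ∀ m : α → β → Prop, (∀ a b, m a b → E a b) →
        (∀ a b b', m a b → m a b' → b = b') → (∀ a a' b, m a b → m a' b → a = a') →
        ∑ a with ∃ b, m a b ∧ ∀ c, f a = some c → r a b < r a c, w a ≤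
          ∑ a with ∃ b, f a = some b ∧ ∀ c, m a c → r a b < r a c, w a := by
  let v : α → Option β → ℕ := fun a o => o.elim 0 fun b => 1 + ∑ c, r a c - r a b
  have hle : ∀ a b, r a b ≤ ∑ c, r a c := fun a b =>
    Finset.single_le_sum (f := r a) (fun _ _ => Nat.zero_le _) (Finset.mem_univ b)
  have hv : ∀ a b, v a none < v a (some b) := by
    intro a b
    have := hle a b
    simp only [v, Option.elim]
    omega
  have hvlt : ∀ a b c, v a (some c) < v a (some b) ↔ r a b < r a c := by
    intro a b c
    have := hle a b
    have := hle a c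
    simp only [v, Option.elim]
    omega
  have hpref : ∀ a (o o' : Option β),
      v a o' < v a o ↔ ∃ b, o = some b ∧ ∀ c, o' = some c → r a b < r a c := by
    intro a o o'
    rcases o with _ | b <;> rcases o' with _ | c
    · simp
    · simpa using (hv a c).le
    · simpa using hv a b
    · simpa using hvlt a b c
  obtain ⟨f, hfE, hf2, hf⟩ := exists_popular_assignment E w hw v hv
  refine ⟨f, hfE, hf2, fun m hmE hfun hinj => ?_⟩
  have hex : ∀ a, ∃ o : Option β, ∀ b, o = some b ↔ m a b := by
    intro a
    by_cases h : ∃ b, m a b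
    · obtain ⟨b, hb⟩ := h
      exact ⟨some b, fun c => ⟨fun hc => by cases hc; exact hb,
        fun hc => by rw [hfun a b c hb hc]⟩⟩
    · push Not at h
      exact ⟨none, fun b => by simpa using h b⟩
  choose p hp using hex
  have := hf p (fun a b h => hmE a b ((hp a b).1 h))
    (fun a a' b h h' => hinj a a' b ((hp a b).1 h) ((hp a' b).1 h'))
  simpa only [hpref, hp] using this

lemma ite_le_ite_of_imp {w : ℝ} {p q : Prop} {_ : Decidable p} {_ : Decidable q} (hw : 0 ≤ w)
    (hpq : p → q) : (if p then w else 0) ≤ if q then w else 0 := by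
  by_cases hp : p
  · rw [if_pos hp, if_pos (hpq hp)]
  · rw [if_neg hp]; split_ifs <;> simp [hw]

end MG

/-- Every marriage instance with nonnegative agent weights and preference lists that
may contain ties admits a popular winning set of cardinality 3. -/
theorem marriage_popular_dimension_le_three
    {α β : Type*} [Fintype α] [Fintype β] (E : Finset (α × β))
    (wA : α → ℝ) (wB : β → ℝ) (hwA : ∀ i, 0 ≤ wA i) (hwB : ∀ j, 0 ≤ wB j)
    (rA : α → β → ℕ) (rB : β → α → ℕ) :
    ∃ M₁ M₂ M₃ : Finset (α × β),
      MG.IsMatching E M₁ ∧ MG.IsMatching E M₂ ∧ MG.IsMatching E M₃ ∧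
      ∀ M' : Finset (α × β), MG.IsMatching E M' →
        MG.phiSet wA wB rA rB {M₁, M₂, M₃} M' ≥ MG.phiSet' wA wB rA rB M' {M₁, M₂, M₃} := by
  obtain ⟨f, hfE, hf2, hf⟩ :=
    MG.exists_popular_assignment_rank (fun a b => (a, b) ∈ E) wA hwA rA
  obtain ⟨g, hgE, hg2, hg⟩ :=
    MG.exists_popular_assignment_rank (fun b a => (a, b) ∈ E) wB hwB rB
  obtain ⟨M, hM, hcov⟩ := MG.exists_matchings_of_degree_le E 3
    (fun a b => (if f a = some b then 1 else 0) + if g b = some a then 1 else 0)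
    (by
      intro a b h
      by_cases h1 : f a = some b
      · exact hfE a b h1
      · by_cases h2 : g b = some a
        · exact hgE b a h2
        · simp [h1, h2] at h)
    (by
      intro a
      have h1 := MG.sum_ite_eq_some_le_one (f a)
      have h2 := hg2 a
      rw [MG.load, Finset.card_filter] at h2
      rw [Finset.sum_add_distrib]
      omega)
    (by
      intro b
      have h1 := MG.sum_ite_eq_some_le_one (g b)
      have h2 := hf2 b
      rw [MG.load, Finset.card_filter] at h2
      rw [Finset.sum_add_distrib]
      omega)
  have hmem : ∀ k, M k ∈ ({M 0, M 1, M 2} : Set (Finset (α × β))) := by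
    intro k
    fin_cases k <;> simp
  refine ⟨M 0, M 1, M 2, hM 0, hM 1, hM 2, fun M' hM' => ?_⟩
  obtain ⟨hE', hA', hB'⟩ := hM'
  have hA := hf (fun a b => (a, b) ∈ M') (fun a b h => hE' h)
    (fun a b b' h h' => congrArg Prod.snd (hA' _ h _ h' rfl))
    (fun a a' b h h' => congrArg Prod.fst (hB' _ h _ h' rfl))
  have hB := hg (fun b a => (a, b) ∈ M') (fun b a h => hE' h)
    (fun b a a' h h' => congrArg Prod.fst (hB' _ h _ h' rfl))
    (fun b b' a h h' => congrArg Prod.snd (hA' _ h _ h' rfl))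
  rw [Finset.sum_filter, Finset.sum_filter] at hA hB
  refine add_le_add
    (le_trans (Finset.sum_le_sum fun i _ => MG.ite_le_ite_of_imp (hwA i) fun hi => ?_)
      (hA.trans (Finset.sum_le_sum fun i _ => MG.ite_le_ite_of_imp (hwA i) fun hi => ?_)))
    (le_trans (Finset.sum_le_sum fun i _ => MG.ite_le_ite_of_imp (hwB i) fun hi => ?_)
      (hB.trans (Finset.sum_le_sum fun i _ => MG.ite_le_ite_of_imp (hwB i) fun hi => ?_)))
  · cases hfi : f i with
    | none =>
      obtain ⟨⟨_, b⟩, hp, rfl, -⟩ := hi _ (hmem 0)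
      exact ⟨b, hp, by simp⟩
    | some c =>
      obtain ⟨k, hk⟩ := hcov i c (by simp [hfi])
      obtain ⟨⟨_, b⟩, hp, rfl, h⟩ := hi _ (hmem k)
      exact ⟨b, hp, fun c' hc' => by cases hc'; exact h _ hk rfl⟩
  · obtain ⟨b, hb, h⟩ := hi
    obtain ⟨k, hk⟩ := hcov i b (by simp [hb])
    exact ⟨M k, hmem k, (i, b), hk, rfl, by rintro ⟨_, c⟩ hq rfl; exact h c hq⟩
  · cases hgi : g i with
    | none =>
      obtain ⟨⟨a, _⟩, hp, rfl, -⟩ := hi _ (hmem 0)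
      exact ⟨a, hp, by simp⟩
    | some c =>
      obtain ⟨k, hk⟩ := hcov c i (by simp [hgi])
      obtain ⟨⟨a, _⟩, hp, rfl, h⟩ := hi _ (hmem k)
      exact ⟨a, hp, fun c' hc' => by cases hc'; exact h _ hk rfl⟩
  · obtain ⟨a, ha, h⟩ := hi
    obtain ⟨k, hk⟩ := hcov a i (by simp [ha])
    exact ⟨M k, hmem k, (a, i), hk, rfl, by rintro ⟨c, _⟩ hq rfl; exact h c hq⟩
end

section
/- Every roommates instance with arbitrary nonnegative agent weights and preference lists that may contain ties admits a popular winning set of cardinality 3: there exist matchings M₁, M₂, M₃ such that for every matching M', φ({M₁, M₂, M₃}, M') ≥ φ(M', {M₁, M₂, M₃}). -/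
open scoped Classical

/-- `M` is a matching in the roommates instance on graph `G`:
a set of edges of `G` in which every agent occurs in at most one edge. -/
def RM.IsMatching {V : Type*} (G : SimpleGraph V) (M : Finset (Sym2 V)) : Prop :=
  (∀ e ∈ M, e ∈ G.edgeSet) ∧ ∀ i j j' : V, s(i, j) ∈ M → s(i, j') ∈ M → j = j'

/-- Agent `i` strictly prefers matching `M` over matching `M'`:
`i` is matched in `M` to some `j` and either `i` is unmatched in `M'`
or matched in `M'` to a strictly worse-ranked partner. -/
def RM.Prefers {V : Type*} (r : V → V → ℕ) (M M' : Finset (Sym2 V)) (i : V) : Prop :=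
  ∃ j, s(i, j) ∈ M ∧ ∀ j', s(i, j') ∈ M' → r i j < r i j'

/-- `φ(M, M')`: total weight of agents strictly preferring `M` over `M'`. -/
noncomputable def RM.phi {V : Type*} [Fintype V] (w : V → ℝ) (r : V → V → ℕ)
    (M M' : Finset (Sym2 V)) : ℝ :=
  ∑ i, if RM.Prefers r M M' i then w i else 0

/-- `φ(𝓜, M')`: total weight of agents strictly preferring some matching of `𝓜` over `M'`. -/
noncomputable def RM.phiSet {V : Type*} [Fintype V] (w : V → ℝ) (r : V → V → ℕ)
    (𝓜 : Set (Finset (Sym2 V))) (M' : Finset (Sym2 V)) : ℝ :=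
  ∑ i, if ∃ M ∈ 𝓜, RM.Prefers r M M' i then w i else 0

/-- `φ(M', 𝓜)`: total weight of agents strictly preferring `M'` over every matching of `𝓜`. -/
noncomputable def RM.phiSet' {V : Type*} [Fintype V] (w : V → ℝ) (r : V → V → ℕ)
    (M' : Finset (Sym2 V)) (𝓜 : Set (Finset (Sym2 V))) : ℝ :=
  ∑ i, if ∀ M ∈ 𝓜, RM.Prefers r M' M i then w i else 0

namespace RM

open Finset

variable {V : Type*}

/-- If every level set `{w ≥ θ}` meets `I` in at most as many points as `D`, then `I` weighs at
most as much as `D`. -/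
theorem sum_le_sum_of_card_level_le (w : V → ℝ) (hw : ∀ i, 0 ≤ w i) (I D : Finset V)
    (h : ∀ θ : ℝ, #{i ∈ I | θ ≤ w i} ≤ #{i ∈ D | θ ≤ w i}) :
    ∑ i ∈ I, w i ≤ ∑ i ∈ D, w i := by
  induction I using Finset.strongInduction generalizing D with
  | H I ih =>
    rcases I.eq_empty_or_nonempty with rfl | hI
    · simpa using sum_nonneg fun i (_ : i ∈ D) => hw i
    obtain ⟨i, hi, hmax⟩ := I.exists_max_image w hI
    have hpos : 0 < #{d ∈ D | w i ≤ w d} :=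
      (card_pos.2 ⟨i, mem_filter.2 ⟨hi, le_refl (w i)⟩⟩).trans_le (h (w i))
    obtain ⟨d, hd⟩ := card_pos.1 hpos
    obtain ⟨hdD, hid⟩ := mem_filter.1 hd
    have hrec := ih (I.erase i) (erase_ssubset hi) (D.erase d) fun θ => by
      by_cases hθ : θ ≤ w i
      · rw [filter_erase, filter_erase, card_erase_of_mem (mem_filter.2 ⟨hi, hθ⟩),
          card_erase_of_mem (mem_filter.2 ⟨hdD, hθ.trans hid⟩)]
        exact Nat.sub_le_sub_right (h θ) 1
      · have hempty : {c ∈ I.erase i | θ ≤ w c} = ∅ :=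
          filter_eq_empty_iff.2 fun c hc hcθ => hθ (hcθ.trans (hmax c (mem_of_mem_erase hc)))
        rw [hempty]
        simp
    rw [← add_sum_erase I w hi, ← add_sum_erase D w hdD]
    linarith

/-- The rank that agent `c` gives to an optional partner, being unmatched having rank `B`. -/
def cost (r : V → V → ℕ) (B : ℕ) (c : V) (o : Option V) : ℕ := o.elim B (r c)

theorem cost_le {r : V → V → ℕ} {B : ℕ} (hB : ∀ i j, r i j < B) (c : V) (o : Option V) :
    cost r B c o ≤ B := by
  cases o with
  | none => exact le_rfl
  | some j => exact (hB c j).le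

variable [Fintype V]

/-- The agents that select `j`. -/
noncomputable def selectors (τ : V → Option V) (j : V) : Finset V := {c | τ c = some j}

theorem mem_selectors {τ : V → Option V} {j c : V} : c ∈ selectors τ j ↔ τ c = some j := by
  simp [selectors]

/-- Every agent selects at most one neighbour, and is selected by at most two agents. -/
def IsSelection (G : SimpleGraph V) (τ : V → Option V) : Prop :=
  (∀ c j, τ c = some j → G.Adj c j) ∧ ∀ j, #(selectors τ j) ≤ 2

/-- The agent `d` selects the same agent as `c`, or one of `c`, `d` selects the other. -/
def Conflict (σ : V → Option V) (c d : V) : Prop :=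
  σ c = σ d ∨ σ c = some d ∨ σ d = some c

theorem exists_card_conflict_le_two (σ : V → Option V) (hσ : ∀ j, #(selectors σ j) ≤ 2)
    (S : Finset V) (hS : S.Nonempty) (hsome : ∀ c ∈ S, σ c ≠ none) :
    ∃ c ∈ S, #{d ∈ S | d ≠ c ∧ Conflict σ c d} ≤ 2 := by
  by_cases hleaf : ∃ c ∈ S, ∀ d ∈ S, σ d ≠ some c
  · obtain ⟨c, hc, hcd⟩ := hleaf
    obtain ⟨j, hj⟩ := Option.ne_none_iff_exists'.1 (hsome c hc)
    refine ⟨c, hc, ?_⟩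
    have hsub : {d ∈ S | d ≠ c ∧ Conflict σ c d} ⊆ insert j ((selectors σ j).erase c) := by
      intro d hd
      obtain ⟨hdS, hne, h | h | h⟩ := by simpa using hd
      · simp [mem_selectors, hne, ← h, hj]
      · simp_all
      · exact absurd h (hcd d hdS)
    have h1 := card_le_card hsub
    have h2 := card_insert_le j ((selectors σ j).erase c)
    rw [card_erase_of_mem (mem_selectors.2 hj)] at h2
    have h3 := hσ j
    omega
  · push Not at hleaf
    choose! g hgS hg using hleaf
    have hinj : Set.InjOn g S := fun a ha b hb hab => by
      have h := hg a ha
      rw [hab, hg b hb] at h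
      exact (Option.some.inj h).symm
    have hsurj : ∀ d ∈ S, ∃ c ∈ S, g c = d := fun d hd =>
      surj_on_of_inj_on_of_card_le (fun c _ => g c) hgS (fun a b ha hb => hinj ha hb) le_rfl d hd
        |>.imp fun c ⟨hc, h⟩ => ⟨hc, h.symm⟩
    obtain ⟨c, hc⟩ := hS
    obtain ⟨p, hp, rfl⟩ := hsurj c hc
    refine ⟨g p, hc, ?_⟩
    have hsub : {d ∈ S | d ≠ g p ∧ Conflict σ (g p) d} ⊆ {p, g (g p)} := by
      intro d hd
      obtain ⟨hdS, hne, h⟩ := by simpa using hd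
      obtain ⟨q, hq, rfl⟩ := hsurj d hdS
      rcases h with h | h | h
      · rw [hg p hp, hg q hq] at h
        exact absurd (congrArg g (Option.some.inj h).symm) hne
      · rw [hg p hp] at h
        simp [Option.some.inj h]
      · rw [hg q hq] at h
        simp [Option.some.inj h]
    exact (card_le_card hsub).trans card_le_two

/-- The edges chosen by a selection can be properly coloured with three colours. -/
theorem exists_coloring (σ : V → Option V) (hσ : ∀ j, #(selectors σ j) ≤ 2) :
    ∃ col : V → Fin 3, ∀ c d, σ c ≠ none → σ d ≠ none → d ≠ c → Conflict σ c d →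
      col c ≠ col d := by
  suffices h : ∀ S : Finset V, (∀ c ∈ S, σ c ≠ none) → ∃ col : V → Fin 3, ∀ c ∈ S, ∀ d ∈ S,
      d ≠ c → Conflict σ c d → col c ≠ col d by
    obtain ⟨col, hcol⟩ := h {c | σ c ≠ none} (by simp)
    exact ⟨col, fun c d hc hd => hcol c (by simpa using hc) d (by simpa using hd)⟩
  intro S
  induction S using Finset.strongInduction with
  | H S ih =>
    intro hsome
    rcases S.eq_empty_or_nonempty with rfl | hS
    · exact ⟨fun _ => 0, by simp⟩
    obtain ⟨c, hc, hcard⟩ := exists_card_conflict_le_two σ hσ S hS hsome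
    obtain ⟨col, hcol⟩ := ih (S.erase c) (erase_ssubset hc)
      fun d hd => hsome d (mem_of_mem_erase hd)
    obtain ⟨k, hk⟩ : ∃ k, k ∉ ({d ∈ S | d ≠ c ∧ Conflict σ c d}).image col := by
      by_contra! hall
      have h := card_le_card (fun k _ => hall k : (univ : Finset (Fin 3)) ⊆ _)
      have h' := h.trans card_image_le
      rw [card_univ, Fintype.card_fin] at h'
      omega
    have hfree : ∀ d ∈ S, d ≠ c → Conflict σ c d → col d ≠ k := fun d hd hne hconf hdk =>
      hk (mem_image.2 ⟨d, mem_filter.2 ⟨hd, hne, hconf⟩, hdk⟩)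
    refine ⟨Function.update col c k, fun a ha b hb hne hconf => ?_⟩
    by_cases hac : a = c
    · subst hac
      rw [Function.update_self, Function.update_of_ne hne]
      exact (hfree b hb hne hconf).symm
    rw [Function.update_of_ne hac]
    by_cases hbc : b = c
    · subst hbc
      rw [Function.update_self]
      refine hfree a ha hac ?_
      rcases hconf with h | h | h
      exacts [Or.inl h.symm, Or.inr (Or.inr h), Or.inr (Or.inl h)]
    rw [Function.update_of_ne hbc]
    exact hcol a (mem_erase.2 ⟨hac, ha⟩) b (mem_erase.2 ⟨hbc, hb⟩) hne hconf

/-- A selection that is Pareto optimal, and in which an agent can be improved at the expense of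
a single other agent only if the latter is at least as heavy. -/
structure IsOptimalSelection (G : SimpleGraph V) (w : V → ℝ) (r : V → V → ℕ) (B : ℕ)
    (σ : V → Option V) : Prop where
  isSelection : IsSelection G σ
  pareto : ∀ τ, IsSelection G τ → (∀ c, cost r B c (τ c) ≤ cost r B c (σ c)) →
    ∀ c, ¬ cost r B c (τ c) < cost r B c (σ c)
  weight_le : ∀ τ, IsSelection G τ → ∀ i b, i ≠ b → cost r B i (τ i) < cost r B i (σ i) →
    (∀ c, c ≠ b → cost r B c (τ c) ≤ cost r B c (σ c)) → w i ≤ w b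

theorem exists_isOptimalSelection (G : SimpleGraph V) (w : V → ℝ) (r : V → V → ℕ) {B : ℕ}
    (hB : ∀ i j, r i j < B) : ∃ σ, IsOptimalSelection G w r B σ := by
  let f : V → ℕ := fun c => (B + 1) ^ #{d | w d < w c}
  have hf : ∀ c, 0 < f c := fun c => by positivity
  have hmem : (fun _ => none) ∈ ({τ | IsSelection G τ} : Finset (V → Option V)) := by
    refine mem_filter.2 ⟨mem_univ _, fun c j h => by simp at h, fun j => ?_⟩
    simp [selectors]
  obtain ⟨σ, hσ, hmin⟩ := exists_min_image ({τ | IsSelection G τ} : Finset (V → Option V))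
    (fun τ => ∑ c, f c * cost r B c (τ c)) ⟨_, hmem⟩
  refine ⟨σ, (mem_filter.1 hσ).2, fun τ hτ hle c hlt => ?_, fun τ hτ i b hib hlt hle => ?_⟩
  · have h := hmin τ (by simpa using hτ)
    refine h.not_gt (sum_lt_sum (fun d _ => Nat.mul_le_mul_left _ (hle d)) ⟨c, mem_univ c, ?_⟩)
    exact Nat.mul_lt_mul_of_pos_left hlt (hf c)
  · by_contra! hbi
    have h := hmin τ (by simpa using hτ)
    have hfi : f b * (B + 1) ≤ f i := by
      rw [← pow_succ]
      refine Nat.pow_le_pow_right (by omega) (card_lt_card ?_)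
      refine Finset.ssubset_iff_subset_ne.2 ⟨fun d hd => ?_, fun heq => ?_⟩
      · simp only [mem_filter, mem_univ, true_and] at hd ⊢
        exact hd.trans hbi
      · have hb : b ∈ ({d | w d < w i} : Finset V) := by simpa using hbi
        rw [← heq] at hb
        simp at hb
    have hb : b ∈ univ.erase i := by simp [hib.symm]
    have hrest : ∑ c ∈ (univ.erase i).erase b, f c * cost r B c (τ c) ≤
        ∑ c ∈ (univ.erase i).erase b, f c * cost r B c (σ c) :=
      sum_le_sum fun c hc => Nat.mul_le_mul_left _ (hle c (ne_of_mem_erase hc))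
    rw [← add_sum_erase univ _ (mem_univ i), ← add_sum_erase (univ.erase i) _ hb,
      ← add_sum_erase univ _ (mem_univ i), ← add_sum_erase (univ.erase i) _ hb] at h
    have h1 : f i * cost r B i (τ i) + f i ≤ f i * cost r B i (σ i) :=
      Nat.mul_le_mul_left (f i) hlt
    have h2 : f b * cost r B b (τ b) ≤ f b * B := Nat.mul_le_mul_left _ (cost_le hB b _)
    have h3 := hf b
    rw [Nat.mul_succ] at hfi
    omega

theorem card_selectors_update_none_le (τ : V → Option V) (a j : V) :
    #(selectors (Function.update τ a none) j) ≤ #(selectors τ j) := by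
  refine card_le_card fun c hc => ?_
  rw [mem_selectors] at hc ⊢
  by_cases h : c = a <;> simp_all

theorem card_selectors_update_update_le {τ : V → Option V} {a b j : V} (hb : τ b = some j)
    (k : V) : #(selectors (Function.update (Function.update τ a (some j)) b none) k) ≤
      #(selectors τ k) := by
  by_cases hk : k = j
  · subst hk
    have hsub : selectors (Function.update (Function.update τ a (some k)) b none) k ⊆
        insert a ((selectors τ k).erase b) := by
      intro c hc
      rw [mem_selectors] at hc
      rw [mem_insert, mem_erase, mem_selectors]
      by_cases h : c = b <;> by_cases h' : c = a <;> simp_all [Function.update_apply]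
    have h1 := card_le_card hsub
    have h2 := card_insert_le a ((selectors τ k).erase b)
    have h3 := card_erase_add_one (mem_selectors.2 hb)
    omega
  · refine card_le_card fun c hc => ?_
    rw [mem_selectors] at hc ⊢
    by_cases h : c = b <;> by_cases h' : c = a <;> simp_all [Function.update_apply]

theorem card_selectors_update_le (τ : V → Option V) (a : V) (o : Option V) (k : V) :
    #(selectors (Function.update τ a o) k) ≤ #(selectors τ k) + if o = some k then 1 else 0 := by
  split_ifs with ho
  · refine (card_le_card fun c hc => ?_).trans (card_insert_le a (selectors τ k))
    rw [mem_selectors] at hc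
    rw [mem_insert, mem_selectors]
    by_cases h : c = a <;> simp_all
  · refine card_le_card fun c hc => ?_
    rw [mem_selectors] at hc ⊢
    by_cases h : c = a <;> simp_all

/-- Every `b ∈ S` can be freed from its selection by moving only agents of `S`, such that
no other agent gets worse and, unless `b ∈ I`, some agent of `I` improves. -/
def IsExchangeSet (G : SimpleGraph V) (r : V → V → ℕ) (B : ℕ) (σ : V → Option V)
    (I S : Finset V) : Prop :=
  I ⊆ S ∧ ∀ b ∈ S, ∃ τ : V → Option V, τ b = none ∧ (∀ c, c ∉ S → τ c = σ c) ∧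
    (∀ c j, τ c = some j → G.Adj c j) ∧ (∀ j, #(selectors τ j) ≤ #(selectors σ j)) ∧
    (∀ c, c ≠ b → cost r B c (τ c) ≤ cost r B c (σ c)) ∧
    (b ∈ I ∨ ∃ i ∈ I, i ≠ b ∧ cost r B i (τ i) < cost r B i (σ i))

theorem isExchangeSet_self {G : SimpleGraph V} {r : V → V → ℕ} {B : ℕ} {σ : V → Option V}
    (hσ : IsSelection G σ) (I : Finset V) : IsExchangeSet G r B σ I I := by
  refine ⟨Subset.rfl, fun b hb => ⟨Function.update σ b none, Function.update_self .., ?_, ?_,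
    card_selectors_update_none_le σ b, ?_, Or.inl hb⟩⟩
  · rintro c hc
    exact Function.update_of_ne (fun h : c = b => hc (h ▸ hb)) ..
  · intro c j hcj
    by_cases h : c = b
    · simp [h] at hcj
    · exact hσ.1 c j (by rwa [Function.update_of_ne h] at hcj)
  · intro c hc
    rw [Function.update_of_ne hc]

theorem IsExchangeSet.insert {G : SimpleGraph V} {r : V → V → ℕ} {B : ℕ} {σ : V → Option V}
    {I S : Finset V} (hS : IsExchangeSet G r B σ I S) {a b j : V} (ha : a ∈ S) (hb : b ∉ S)
    (hj : σ b = some j) (haj : G.Adj a j) (hle : r a j ≤ cost r B a (σ a))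
    (hlt : a ∈ I → r a j < cost r B a (σ a)) : IsExchangeSet G r B σ I (insert b S) := by
  refine ⟨hS.1.trans (subset_insert b S), fun d hd => ?_⟩
  rcases mem_insert.1 hd with rfl | hd
  · obtain ⟨τ, -, hout, hadj, hcard, hcost, himp⟩ := hS.2 a ha
    have had : a ≠ d := fun h => hb (h ▸ ha)
    refine ⟨Function.update (Function.update τ a (some j)) d none, Function.update_self .., ?_,
      ?_, fun k => (card_selectors_update_update_le ((hout d hb).trans hj) k).trans (hcard k),
      ?_, ?_⟩
    · intro c hc
      rw [mem_insert, not_or] at hc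
      rw [Function.update_of_ne hc.1, Function.update_of_ne fun h : c = a => hc.2 (h ▸ ha)]
      exact hout c hc.2
    · intro c k hck
      by_cases hcd : c = d
      · simp [hcd] at hck
      rw [Function.update_of_ne hcd] at hck
      by_cases hca : c = a
      · subst hca
        rw [Function.update_self] at hck
        exact Option.some.inj hck ▸ haj
      · rw [Function.update_of_ne hca] at hck
        exact hadj c k hck
    · intro c hcd
      rw [Function.update_of_ne hcd]
      by_cases hca : c = a
      · subst hca
        rw [Function.update_self]
        exact hle
      · rw [Function.update_of_ne hca]
        exact hcost c hca
    · right
      rcases himp with haI | ⟨i, hi, hia, hlt'⟩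
      · refine ⟨a, haI, had, ?_⟩
        rw [Function.update_of_ne had, Function.update_self]
        exact hlt haI
      · have hid : i ≠ d := fun h => hb (h ▸ hS.1 hi)
        refine ⟨i, hi, hid, ?_⟩
        rwa [Function.update_of_ne hid, Function.update_of_ne hia]
  · obtain ⟨τ, hτ, hout, hrest⟩ := hS.2 d hd
    exact ⟨τ, hτ, fun c hc => hout c fun h => hc (mem_insert_of_mem h), hrest⟩

/-- Among the agents of weight at least `θ`, at most as many prefer an injective assignment `μ`
to an optimal selection as the other way round. -/
theorem IsOptimalSelection.card_improved_le {G : SimpleGraph V} {w : V → ℝ} {r : V → V → ℕ}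
    {B : ℕ} {σ : V → Option V} (hσ : IsOptimalSelection G w r B σ) {μ : V → Option V}
    (hadj : ∀ c j, μ c = some j → G.Adj c j)
    (hinj : ∀ c d j, μ c = some j → μ d = some j → c = d) (θ : ℝ) :
    #{i | cost r B i (μ i) < cost r B i (σ i) ∧ θ ≤ w i} ≤
      #{i | cost r B i (σ i) < cost r B i (μ i) ∧ θ ≤ w i} := by
  set I : Finset V := {i | cost r B i (μ i) < cost r B i (σ i) ∧ θ ≤ w i}
  obtain ⟨S, hS, hmax⟩ := exists_max_image
    ({S | IsExchangeSet G r B σ I S} : Finset (Finset V)) card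
    ⟨I, by simpa using isExchangeSet_self hσ.isSelection I⟩
  replace hS : IsExchangeSet G r B σ I S := (mem_filter.1 hS).2
  have hSw : ∀ b ∈ S, θ ≤ w b := by
    intro b hb
    obtain ⟨τ, -, -, hτadj, hcard, hcost, hbI | ⟨i, hi, hib, hlt⟩⟩ := hS.2 b hb
    · exact (mem_filter.1 hbI).2.2
    · exact (mem_filter.1 hi).2.2.trans (hσ.weight_le τ
        ⟨hτadj, fun j => (hcard j).trans (hσ.isSelection.2 j)⟩ i b hib hlt hcost)
  have hSI : ∀ a ∈ S, cost r B a (μ a) < cost r B a (σ a) → a ∈ I := fun a ha hlt =>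
    mem_filter.2 ⟨mem_univ a, hlt, hSw a ha⟩
  set A : Finset V := {a ∈ S | cost r B a (μ a) ≤ cost r B a (σ a)} with hA
  have hfull : ∀ a ∈ A, ∃ j, μ a = some j ∧ 2 ≤ #(selectors σ j) := by
    intro a ha
    obtain ⟨haS, hle⟩ := mem_filter.1 ha
    by_contra! hnot
    obtain ⟨τ, hτa, -, hτadj, hcard, hcost, himp⟩ := hS.2 a haS
    have hsel : IsSelection G (Function.update τ a (μ a)) := by
      refine ⟨fun c j hcj => ?_, fun j => ?_⟩
      · by_cases hca : c = a
        · subst hca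
          exact hadj c j (by rwa [Function.update_self] at hcj)
        · exact hτadj c j (by rwa [Function.update_of_ne hca] at hcj)
      · have h1 := card_selectors_update_le τ a (μ a) j
        have h2 := hcard j
        have h3 := hσ.isSelection.2 j
        split_ifs at h1 with hj
        · have h4 := hnot j hj
          omega
        · omega
    have hweak : ∀ c, cost r B c (Function.update τ a (μ a) c) ≤ cost r B c (σ c) := by
      intro c
      by_cases hca : c = a
      · subst hca
        rwa [Function.update_self]
      · rw [Function.update_of_ne hca]
        exact hcost c hca
    rcases himp with haI | ⟨i, -, hia, hlt⟩
    · refine hσ.pareto _ hsel hweak a ?_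
      rw [Function.update_self]
      exact (mem_filter.1 haI).2.1
    · refine hσ.pareto _ hsel hweak i ?_
      rwa [Function.update_of_ne hia]
  choose! p hp hp2 using hfull
  have hclosed : ∀ a ∈ A, selectors σ (p a) ⊆ S := by
    intro a ha b hb
    obtain ⟨haS, hle⟩ := mem_filter.1 ha
    by_contra hbS
    have hlt : a ∈ I → cost r B a (μ a) < cost r B a (σ a) := fun h => (mem_filter.1 h).2.1
    rw [hp a ha] at hle hlt
    have h := hmax (insert b S) (by
      simpa using hS.insert haS hbS (mem_selectors.1 hb) (hadj a _ (hp a ha)) hle hlt)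
    rw [card_insert_of_notMem hbS] at h
    omega
  have hcount : #A * 2 ≤ #S := by
    have hdisj : (A : Set V).PairwiseDisjoint fun a => selectors σ (p a) := by
      intro a ha b hb hab
      refine disjoint_left.2 fun c hca hcb => hab ?_
      rw [mem_selectors] at hca hcb
      have hpab : p a = p b := Option.some.inj (hca.symm.trans hcb)
      exact hinj a b (p a) (hp a ha) (hpab ▸ hp b hb)
    calc #A * 2 ≤ ∑ a ∈ A, #(selectors σ (p a)) := by
          simpa using card_nsmul_le_sum A (fun a => #(selectors σ (p a))) 2 hp2
      _ = #(A.biUnion fun a => selectors σ (p a)) := (card_biUnion hdisj).symm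
      _ ≤ #S := card_le_card (biUnion_subset.2 hclosed)
  have hsplit := card_filter_add_card_filter_not (s := S)
    (fun a => cost r B a (μ a) ≤ cost r B a (σ a))
  have hIA : #I ≤ #A := card_le_card fun i hi =>
    mem_filter.2 ⟨hS.1 hi, (mem_filter.1 hi).2.1.le⟩
  have hD : #{a ∈ S | ¬ cost r B a (μ a) ≤ cost r B a (σ a)} ≤
      #{i | cost r B i (σ i) < cost r B i (μ i) ∧ θ ≤ w i} := by
    refine card_le_card fun a ha => ?_
    obtain ⟨haS, hlt⟩ := mem_filter.1 ha
    exact mem_filter.2 ⟨mem_univ a, not_le.1 hlt, hSw a haS⟩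
  rw [← hA] at hsplit
  omega

/-- The edges of a selection whose selecting agent has colour `k`. -/
noncomputable def colorClass (σ : V → Option V) (col : V → Fin 3) (k : Fin 3) :
    Finset (Sym2 V) :=
  {e | ∃ c j, σ c = some j ∧ col c = k ∧ e = s(c, j)}

theorem mk_mem_colorClass {σ : V → Option V} {col : V → Fin 3} {k : Fin 3} {i j : V} :
    s(i, j) ∈ colorClass σ col k ↔
      (σ i = some j ∧ col i = k) ∨ (σ j = some i ∧ col j = k) := by
  simp only [colorClass, mem_filter, mem_univ, true_and, Sym2.eq_iff]
  constructor
  · rintro ⟨c, d, h, hk, ⟨rfl, rfl⟩ | ⟨rfl, rfl⟩⟩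
    exacts [Or.inl ⟨h, hk⟩, Or.inr ⟨h, hk⟩]
  · rintro (⟨h, hk⟩ | ⟨h, hk⟩)
    exacts [⟨i, j, h, hk, Or.inl ⟨rfl, rfl⟩⟩, ⟨j, i, h, hk, Or.inr ⟨rfl, rfl⟩⟩]

theorem isMatching_colorClass {G : SimpleGraph V} {σ : V → Option V} {col : V → Fin 3}
    (hadj : ∀ c j, σ c = some j → G.Adj c j)
    (hcol : ∀ c d, σ c ≠ none → σ d ≠ none → d ≠ c → Conflict σ c d → col c ≠ col d)
    (k : Fin 3) : IsMatching G (colorClass σ col k) := by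
  refine ⟨fun e he => ?_, fun i j j' hj hj' => ?_⟩
  · obtain ⟨c, j, h, -, rfl⟩ := (mem_filter.1 he).2
    exact hadj c j h
  · rw [mk_mem_colorClass] at hj hj'
    rcases hj with ⟨h, hk⟩ | ⟨h, hk⟩ <;> rcases hj' with ⟨h', hk'⟩ | ⟨h', hk'⟩
    · exact Option.some.inj (h.symm.trans h')
    · exact absurd (hk.trans hk'.symm) (hcol i j' (by simp [h]) (by simp [h'])
        (hadj _ _ h').ne (Or.inr (Or.inr h')))
    · exact absurd (hk'.trans hk.symm) (hcol i j (by simp [h']) (by simp [h])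
        (hadj _ _ h).ne (Or.inr (Or.inr h)))
    · by_contra hne
      exact hcol j j' (by simp [h]) (by simp [h']) (Ne.symm hne) (Or.inl (h.trans h'.symm))
        (hk.trans hk'.symm)

theorem IsMatching.exists_partner {G : SimpleGraph V} {M : Finset (Sym2 V)}
    (hM : IsMatching G M) : ∃ μ : V → Option V, ∀ i j, μ i = some j ↔ s(i, j) ∈ M := by
  refine ⟨fun i => if h : ∃ j, s(i, j) ∈ M then some h.choose else none, fun i j => ?_⟩
  by_cases h : ∃ j, s(i, j) ∈ M
  · simp only [dif_pos h, Option.some.injEq]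
    exact ⟨fun hj => hj ▸ h.choose_spec, fun hj => hM.2 i _ _ h.choose_spec hj⟩
  · simp only [dif_neg h, reduceCtorEq, false_iff]
    exact fun hj => h ⟨j, hj⟩

end RM

/-- Every roommates instance with nonnegative agent weights and preference lists that
may contain ties admits a popular winning set of cardinality 3. -/
theorem roommates_popular_dimension_le_three
    {V : Type*} [Fintype V] (G : SimpleGraph V)
    (w : V → ℝ) (hw : ∀ i, 0 ≤ w i) (r : V → V → ℕ) :
    ∃ M₁ M₂ M₃ : Finset (Sym2 V),
      RM.IsMatching G M₁ ∧ RM.IsMatching G M₂ ∧ RM.IsMatching G M₃ ∧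
      ∀ M' : Finset (Sym2 V), RM.IsMatching G M' →
        RM.phiSet w r {M₁, M₂, M₃} M' ≥ RM.phiSet' w r M' {M₁, M₂, M₃} := by
  obtain ⟨B, hB⟩ : ∃ B, ∀ i j, r i j < B :=
    ⟨(Finset.univ.sup fun i => Finset.univ.sup (r i)) + 1, fun i j => Nat.lt_succ_of_le <|
      (Finset.le_sup (f := r i) (Finset.mem_univ j)).trans
        (Finset.le_sup (f := fun i => Finset.univ.sup (r i)) (Finset.mem_univ i))⟩
  obtain ⟨σ, hσ⟩ := RM.exists_isOptimalSelection G w r hB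
  obtain ⟨col, hcol⟩ := RM.exists_coloring σ hσ.isSelection.2
  have hmatch := RM.isMatching_colorClass hσ.isSelection.1 hcol
  refine ⟨RM.colorClass σ col 0, RM.colorClass σ col 1, RM.colorClass σ col 2,
    hmatch 0, hmatch 1, hmatch 2, fun M' hM' => ?_⟩
  have hmem : ∀ k, RM.colorClass σ col k ∈ ({RM.colorClass σ col 0, RM.colorClass σ col 1,
      RM.colorClass σ col 2} : Set (Finset (Sym2 V))) := by
    intro k
    fin_cases k <;> simp
  obtain ⟨μ, hμ⟩ := hM'.exists_partner
  have hcount := hσ.card_improved_le (μ := μ) (fun c j h => hM'.1 _ ((hμ c j).1 h))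
    fun c d j hc hd => hM'.2 j c d (Sym2.eq_swap ▸ (hμ c j).1 hc) (Sym2.eq_swap ▸ (hμ d j).1 hd)
  have hsum := RM.sum_le_sum_of_card_level_le w hw
    {i | RM.cost r B i (μ i) < RM.cost r B i (σ i)}
    {i | RM.cost r B i (σ i) < RM.cost r B i (μ i)}
    (fun θ => by simpa only [Finset.filter_filter] using hcount θ)
  rw [Finset.sum_filter, Finset.sum_filter] at hsum
  refine le_trans (Finset.sum_le_sum fun i _ => ?_) (hsum.trans (Finset.sum_le_sum fun i _ => ?_))
  · by_cases h : ∀ M ∈ ({RM.colorClass σ col 0, RM.colorClass σ col 1,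
        RM.colorClass σ col 2} : Set (Finset (Sym2 V))), RM.Prefers r M' M i
    · obtain ⟨j, hj, hlt⟩ := h _ (hmem (col i))
      have hi : RM.cost r B i (μ i) < RM.cost r B i (σ i) := by
        rw [(hμ i j).2 hj]
        cases hσi : σ i with
        | none => exact hB i j
        | some j' => exact hlt j' (RM.mk_mem_colorClass.2 (Or.inl ⟨hσi, rfl⟩))
      rw [if_pos h, if_pos hi]
    · rw [if_neg h]
      split_ifs
      exacts [hw i, le_rfl]
  · by_cases hi : RM.cost r B i (σ i) < RM.cost r B i (μ i)
    · have h : ∃ M ∈ ({RM.colorClass σ col 0, RM.colorClass σ col 1,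
          RM.colorClass σ col 2} : Set (Finset (Sym2 V))), RM.Prefers r M M' i := by
        cases hσi : σ i with
        | none =>
          rw [hσi] at hi
          exact absurd hi (RM.cost_le hB i (μ i)).not_gt
        | some j =>
          refine ⟨_, hmem (col i), j, RM.mk_mem_colorClass.2 (Or.inl ⟨hσi, rfl⟩),
            fun j' hj' => ?_⟩
          rw [hσi, (hμ i j').2 hj'] at hi
          exact hi
      rw [if_pos hi, if_pos h]
    · rw [if_neg hi]
      split_ifs
      exacts [hw i, le_rfl]
end
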